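/- Let f: ℝⁿ → ℝ be convex (or more generally such that φ_x(z) = f(z) + (1/(2t))‖z − x‖² is (1/t)-strongly convex with minimizer z*(x)), and define the HJ-Prox approximation prox^δ_{tf}(x) = (∫ y e^{−φ_x(y)/δ} dy)/(∫ e^{−φ_x(y)/δ} dy) for δ, t > 0. Then for every x ∈ ℝⁿ, ‖prox^δ_{tf}(x) − prox_{tf}(x)‖ ≤ √(2 n t δ). -/

import Mathlib

open MeasureTheory

lemma hj_gauss_integrable {n : ℕ} (b : ℝ) (hb : 0 < b) :
    Integrable (fun u : EuclideanSpace ℝ (Fin n) => Real.exp (-b * ‖u‖ ^ 2)) := by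
  have h := GaussianFourier.integrable_cexp_neg_mul_sq_norm_add (b := (b : ℂ)) (by simpa using hb)
    0 (0 : EuclideanSpace ℝ (Fin n))
  have h2 := h.norm
  refine h2.congr (Filter.Eventually.of_forall fun u => ?_)
  simp only [Complex.norm_exp]
  congr 1
  simp [← Complex.ofReal_pow]

lemma hj_core {n : ℕ} (G : EuclideanSpace ℝ (Fin n) → ℝ) (hG : Continuous G) (c : ℝ) (hc : 0 < c)
    (h0 : ∀ u, 0 ≤ G u)
    (hs : ∀ u, ∀ s : ℝ, 0 ≤ s → s ≤ 1 → G (s • u) ≤ s * G u - s * (1 - s) * c * ‖u‖ ^ 2) :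
    Integrable (fun u => Real.exp (-G u)) ∧
    Integrable (fun u => Real.exp (-G u) • u) ∧
    ‖∫ u, Real.exp (-G u) • u‖ ≤ Real.sqrt (n / c) * ∫ u, Real.exp (-G u) := by
  have hlow : ∀ u, c / 2 * ‖u‖ ^ 2 ≤ G u := by
    intro u
    have h1 := hs u (1 / 2) (by norm_num) (by norm_num)
    have h2 := h0 ((1 / 2 : ℝ) • u)
    nlinarith
  have hw : Integrable (fun u => Real.exp (-G u)) := by
    refine (hj_gauss_integrable (n := n) (c / 2) (by positivity)).mono'
      (by fun_prop) (Filter.Eventually.of_forall fun u => ?_)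
    rw [Real.norm_eq_abs, abs_of_pos (Real.exp_pos _)]
    apply Real.exp_le_exp.2
    linarith [hlow u]
  have hw2 : Integrable (fun u => Real.exp (-G u) * ‖u‖ ^ 2) := by
    refine ((hj_gauss_integrable (n := n) (c / 4) (by positivity)).const_mul (4 / c)).mono'
      (by fun_prop) (Filter.Eventually.of_forall fun u => ?_)
    rw [Real.norm_eq_abs, abs_of_nonneg (by positivity)]
    have h1 : c / 4 * ‖u‖ ^ 2 ≤ Real.exp (c / 4 * ‖u‖ ^ 2) := by
      linarith [Real.add_one_le_exp (c / 4 * ‖u‖ ^ 2)]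
    have h2 : Real.exp (-G u) ≤ Real.exp (-(c / 2) * ‖u‖ ^ 2) :=
      Real.exp_le_exp.2 (by linarith [hlow u])
    have h3 : Real.exp (-(c / 4) * ‖u‖ ^ 2)
        = Real.exp (-(c / 2) * ‖u‖ ^ 2) * Real.exp (c / 4 * ‖u‖ ^ 2) := by
      rw [← Real.exp_add]; congr 1; ring
    have h4 : ‖u‖ ^ 2 ≤ 4 / c * Real.exp (c / 4 * ‖u‖ ^ 2) := by
      calc ‖u‖ ^ 2 = 4 / c * (c / 4 * ‖u‖ ^ 2) := by field_simp
        _ ≤ _ := by gcongr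
    rw [h3]
    calc Real.exp (-G u) * ‖u‖ ^ 2
        ≤ Real.exp (-(c / 2) * ‖u‖ ^ 2) * (4 / c * Real.exp (c / 4 * ‖u‖ ^ 2)) := by gcongr
      _ = _ := by ring
  have hw1 : Integrable (fun u => Real.exp (-G u) • u) := by
    refine (hw.add hw2).mono' (by fun_prop) (Filter.Eventually.of_forall fun u => ?_)
    rw [norm_smul, Real.norm_eq_abs, abs_of_pos (Real.exp_pos _)]
    simp only [Pi.add_apply]
    have := Real.exp_pos (-G u)
    have h5 : ‖u‖ ≤ 1 + ‖u‖ ^ 2 := by nlinarith [sq_nonneg (‖u‖ - 1)]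
    nlinarith
  refine ⟨hw, hw1, ?_⟩
  set Z := ∫ u, Real.exp (-G u) with hZ
  set M := ∫ u, Real.exp (-G u) * ‖u‖ ^ 2 with hM
  have hZ0 : 0 ≤ Z := integral_nonneg fun u => (Real.exp_pos _).le
  -- second moment bound
  have key : c * M ≤ n * Z := by
    set ε : ℝ := 1 / (4 * (n + 1)) with hε
    have hn : (0 : ℝ) ≤ n := Nat.cast_nonneg n
    have hε0 : 0 < ε := by positivity
    have hεn : ε * (4 * (n + 1)) = 1 := by rw [hε]; field_simp
    have hε1 : ε ≤ 1 / 4 := by nlinarith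
    have hnε : n * ε ≤ 1 / 4 := by nlinarith
    have hpos : 0 < 1 - ε := by linarith
    have hcv : ∫ u, Real.exp (-G ((1 - ε) • u)) = ((1 - ε) ^ n)⁻¹ * Z := by
      have := Measure.integral_comp_smul (volume : Measure (EuclideanSpace ℝ (Fin n)))
        (fun u => Real.exp (-G u)) (1 - ε)
      rw [this, finrank_euclideanSpace_fin, abs_of_pos (by positivity), smul_eq_mul]
    have hint : Integrable (fun u => Real.exp (-G ((1 - ε) • u))) :=
      (integrable_comp_smul_iff volume (fun u => Real.exp (-G u)) hpos.ne').2 hw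
    have hmono : ∫ u, (Real.exp (-G u) + ε * (3 / 2 - ε) * c * (Real.exp (-G u) * ‖u‖ ^ 2))
        ≤ ∫ u, Real.exp (-G ((1 - ε) • u)) := by
      refine integral_mono (hw.add (hw2.const_mul _)) hint fun u => ?_
      have h1 := hs u (1 - ε) hpos.le (by linarith)
      have h2 := hlow u
      have h3 : -G u + ε * (3 / 2 - ε) * c * ‖u‖ ^ 2 ≤ -G ((1 - ε) • u) := by nlinarith
      have h4 := Real.add_one_le_exp (ε * (3 / 2 - ε) * c * ‖u‖ ^ 2)
      calc Real.exp (-G u) + ε * (3 / 2 - ε) * c * (Real.exp (-G u) * ‖u‖ ^ 2)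
          = Real.exp (-G u) * (ε * (3 / 2 - ε) * c * ‖u‖ ^ 2 + 1) := by ring
        _ ≤ Real.exp (-G u) * Real.exp (ε * (3 / 2 - ε) * c * ‖u‖ ^ 2) := by gcongr
        _ ≤ _ := by rw [← Real.exp_add]; exact Real.exp_le_exp.2 h3
    rw [hcv, integral_add hw (hw2.const_mul _), integral_const_mul, ← hZ, ← hM] at hmono
    have hb : 1 - n * ε ≤ (1 - ε) ^ n := by
      have := one_add_mul_le_pow (a := -ε) (by linarith) n
      simpa [sub_eq_add_neg] using this
    have hinv : ((1 - ε) ^ n)⁻¹ ≤ 1 + n * (ε * (3 / 2 - ε)) := by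
      have h1 : ((1 - ε) ^ n)⁻¹ ≤ (1 - n * ε)⁻¹ := inv_anti₀ (by linarith) hb
      refine h1.trans ?_
      rw [inv_le_iff_one_le_mul₀ (by linarith)]
      have h6 : 1 ≤ (3 / 2 - ε) * (1 - n * ε) := by
        have e : n * ε = 1 / 4 - ε := by linarith
        rw [e]; nlinarith
      have h7 : 0 ≤ n * ε := by positivity
      nlinarith
    have h8 := hmono.trans (mul_le_mul_of_nonneg_right hinv hZ0)
    have h9 : 0 < ε * (3 / 2 - ε) := mul_pos hε0 (by linarith)
    have h10 : (ε * (3 / 2 - ε)) * (c * M) ≤ (ε * (3 / 2 - ε)) * (n * Z) := by nlinarith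
    exact le_of_mul_le_mul_left h10 h9
  rcases Nat.eq_zero_or_pos n with rfl | hnpos
  · rw [Subsingleton.elim (∫ u, Real.exp (-G u) • u) 0, norm_zero]
    positivity
  set R := Real.sqrt (n / c) with hR
  have hnp : (0 : ℝ) < n := by exact_mod_cast hnpos
  have hR0 : 0 < R := Real.sqrt_pos.2 (by positivity)
  have hR2 : R ^ 2 = n / c := Real.sq_sqrt (by positivity)
  have hstep : ‖∫ u, Real.exp (-G u) • u‖
      ≤ ∫ u, (R / 2 * Real.exp (-G u) + 1 / (2 * R) * (Real.exp (-G u) * ‖u‖ ^ 2)) := by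
    refine (norm_integral_le_integral_norm _).trans
      (integral_mono hw1.norm ((hw.const_mul _).add (hw2.const_mul _)) fun u => ?_)
    simp only [norm_smul, Real.norm_eq_abs, abs_of_pos (Real.exp_pos _)]
    have h5 : ‖u‖ ≤ R / 2 + 1 / (2 * R) * ‖u‖ ^ 2 := by
      have : R / 2 + 1 / (2 * R) * ‖u‖ ^ 2 - ‖u‖ = (R - ‖u‖) ^ 2 / (2 * R) := by
        field_simp; ring
      have h : 0 ≤ (R - ‖u‖) ^ 2 / (2 * R) := by positivity
      linarith
    calc Real.exp (-G u) * ‖u‖ ≤ Real.exp (-G u) * (R / 2 + 1 / (2 * R) * ‖u‖ ^ 2) := by gcongr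
      _ = _ := by ring
  rw [integral_add (hw.const_mul _) (hw2.const_mul _), integral_const_mul, integral_const_mul,
    ← hZ, ← hM] at hstep
  have hM' : M ≤ R ^ 2 * Z := by
    rw [hR2, div_mul_eq_mul_div, le_div_iff₀ hc]; linarith
  calc _ ≤ _ := hstep
    _ ≤ R / 2 * Z + 1 / (2 * R) * (R ^ 2 * Z) := by gcongr
    _ = R * Z := by field_simp; ring

/-- HJ-Prox error bound. For `f` convex (so that
`φ_x(z) = f(z) + (1/(2t))‖z − x‖²` is `(1/t)`-strongly convex with minimizer
`z*(x) = prox_{tf}(x)`), the HJ-Prox approximation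
`prox^δ_{tf}(x) = (∫ y e^{−φ_x(y)/δ} dy)⁻¹-normalized Gibbs mean` satisfies
`‖prox^δ_{tf}(x) − prox_{tf}(x)‖ ≤ √(2ntδ)` for every `x`. -/
theorem hj_prox_error_bound
    (n : ℕ) (t δ : ℝ) (ht : 0 < t) (hδ : 0 < δ)
    (f : EuclideanSpace ℝ (Fin n) → ℝ)
    (hf_conv : ConvexOn ℝ Set.univ f)
    (φ : EuclideanSpace ℝ (Fin n) → EuclideanSpace ℝ (Fin n) → ℝ)
    (hφ : ∀ x z, φ x z = f z + (1 / (2 * t)) * ‖z - x‖ ^ 2)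
    (prox : EuclideanSpace ℝ (Fin n) → EuclideanSpace ℝ (Fin n))
    (hprox : ∀ x, IsMinOn (φ x) Set.univ (prox x))
    (hjprox : EuclideanSpace ℝ (Fin n) → EuclideanSpace ℝ (Fin n))
    (hhj : ∀ x, hjprox x =
      (∫ y : EuclideanSpace ℝ (Fin n), Real.exp (-(φ x y) / δ))⁻¹ •
        ∫ y : EuclideanSpace ℝ (Fin n), Real.exp (-(φ x y) / δ) • y) :
    ∀ x, ‖hjprox x - prox x‖ ≤ Real.sqrt (2 * n * t * δ) := by
  intro x
  set z := prox x with hz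
  have hfc : Continuous f := continuousOn_univ.1 (hf_conv.continuousOn isOpen_univ)
  have hφc : Continuous (φ x) := by
    have : φ x = fun y => f y + (1 / (2 * t)) * ‖y - x‖ ^ 2 := funext (hφ x)
    rw [this]; fun_prop
  set G : EuclideanSpace ℝ (Fin n) → ℝ := fun u => (φ x (u + z) - φ x z) / δ with hGdef
  have hG : Continuous G := by fun_prop
  have h0 : ∀ u, 0 ≤ G u := fun u =>
    div_nonneg (sub_nonneg.2 (hprox x (Set.mem_univ (u + z)))) hδ.le
  have hs : ∀ u, ∀ s : ℝ, 0 ≤ s → s ≤ 1 →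
      G (s • u) ≤ s * G u - s * (1 - s) * (1 / (2 * t * δ)) * ‖u‖ ^ 2 := by
    intro u s hs0 hs1
    have hcv := hf_conv.2 (Set.mem_univ (u + z)) (Set.mem_univ z) hs0 (sub_nonneg.2 hs1)
      (by ring)
    have e1 : s • (u + z) + (1 - s) • z = s • u + z := by module
    rw [e1, smul_eq_mul, smul_eq_mul] at hcv
    have n1 : ‖u + z - x‖ ^ 2 = ‖u‖ ^ 2 + 2 * inner ℝ u (z - x) + ‖z - x‖ ^ 2 := by
      rw [add_sub_assoc, norm_add_sq_real]
    have n2 : ‖s • u + z - x‖ ^ 2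
        = s ^ 2 * ‖u‖ ^ 2 + 2 * (s * inner ℝ u (z - x)) + ‖z - x‖ ^ 2 := by
      rw [add_sub_assoc, norm_add_sq_real, inner_smul_left, norm_smul, mul_pow,
        Real.norm_eq_abs, sq_abs]
      simp
    have hmain : φ x (s • u + z) - φ x z ≤
        s * (φ x (u + z) - φ x z) - s * (1 - s) * (1 / (2 * t)) * ‖u‖ ^ 2 := by
      simp only [hφ, n1, n2]
      nlinarith
    calc G (s • u) ≤ (s * (φ x (u + z) - φ x z) - s * (1 - s) * (1 / (2 * t)) * ‖u‖ ^ 2) / δ :=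
          div_le_div_of_nonneg_right hmain hδ.le
      _ = _ := by simp only [hGdef]; field_simp
  obtain ⟨hw, hw1, hbd⟩ := hj_core G hG (1 / (2 * t * δ)) (by positivity) h0 hs
  set K := Real.exp (-(φ x z) / δ) with hK
  have hKpos : 0 < K := Real.exp_pos _
  have hfac : ∀ u, Real.exp (-(φ x (u + z)) / δ) = K * Real.exp (-G u) := by
    intro u
    rw [hK, ← Real.exp_add]; congr 1; simp only [hGdef]; ring
  have hZpos : 0 < ∫ u, Real.exp (-G u) := integral_exp_pos hw
  have I1 : ∫ y, Real.exp (-(φ x y) / δ) = K * ∫ u, Real.exp (-G u) := by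
    rw [← integral_add_right_eq_self _ z, ← integral_const_mul]
    simp only [hfac]
  have I2 : ∫ y, Real.exp (-(φ x y) / δ) • y
      = K • ((∫ u, Real.exp (-G u) • u) + (∫ u, Real.exp (-G u)) • z) := by
    rw [← integral_add_right_eq_self _ z, ← integral_smul_const, ← integral_add hw1
      (hw.smul_const z), ← integral_smul]
    simp only [hfac, mul_smul, smul_add]
  have hdiff : hjprox x - z = (∫ u, Real.exp (-G u))⁻¹ • ∫ u, Real.exp (-G u) • u := by
    rw [hhj, I1, I2, smul_smul, smul_add, smul_smul]
    have a1 : (K * ∫ u, Real.exp (-G u))⁻¹ * K = (∫ u, Real.exp (-G u))⁻¹ := by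
      field_simp
    rw [a1, inv_mul_cancel₀ hZpos.ne', one_smul, add_sub_cancel_right]
  have hcon : (n : ℝ) / (1 / (2 * t * δ)) = 2 * n * t * δ := by field_simp
  rw [hcon] at hbd
  rw [hdiff, norm_smul, norm_inv, Real.norm_eq_abs, abs_of_pos hZpos, inv_mul_le_iff₀ hZpos]
  linarith
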